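/- Let n ≥ 1 and let r, Q, Δ, s be positive reals with Q ≥ s² + 2rs + Δ. Define g : ℝⁿ → ℝⁿ by g(z) = (2(r²+Q)/(r² − |z|² + Q)²)·z, where |·| is the Euclidean norm. Let a, b ∈ ℝⁿ satisfy |a| ≤ r and |b − a| ≤ s. Then for every component index k, |g(a)_k − g(b)_k| ≤ γ·|a_k − b_k| + η·‖a − b‖_∞, where γ = 2(r²+Q)/Δ², η = 4(r²+Q)²(2r+s)·√n·r/(Q²·Δ²), and ‖·‖_∞ denotes the maximum absolute value of the components. -/

import Mathlib

/-- Proposition 3: componentwise Lipschitz-type bound on the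
gradient `g(z) = (2(r²+Q)/(r² − |z|² + Q)²)·z` of the potential. -/
theorem stmt_5 (n : ℕ) (hn : 1 ≤ n) (r Q Δ s : ℝ)
    (hr : 0 < r) (hQ : 0 < Q) (hΔ : 0 < Δ) (hs : 0 < s)
    (hQbig : s ^ 2 + 2 * r * s + Δ ≤ Q)
    (g : EuclideanSpace ℝ (Fin n) → EuclideanSpace ℝ (Fin n))
    (hg : ∀ z, g z = (2 * (r ^ 2 + Q) / (r ^ 2 - ‖z‖ ^ 2 + Q) ^ 2) • z)
    (a b : EuclideanSpace ℝ (Fin n)) (ha : ‖a‖ ≤ r) (hb : ‖b - a‖ ≤ s) :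
    ∀ k : Fin n,
      |g a k - g b k| ≤ (2 * (r ^ 2 + Q) / Δ ^ 2) * |a k - b k|
        + (4 * (r ^ 2 + Q) ^ 2 * (2 * r + s) * Real.sqrt n * r / (Q ^ 2 * Δ ^ 2))
            * (⨆ j : Fin n, |a j - b j|) := by
  intro k
  set M := ⨆ j : Fin n, |a j - b j| with hM
  have hbd : BddAbove (Set.range fun j : Fin n => |a j - b j|) := Set.finite_range _ |>.bddAbove
  have hMj : ∀ j, |a j - b j| ≤ M := fun j => le_ciSup hbd j
  have hM0 : 0 ≤ M := (abs_nonneg _).trans (hMj k)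
  have hnorm : ‖a - b‖ ≤ Real.sqrt n * M := by
    rw [EuclideanSpace.norm_eq]
    apply Real.sqrt_le_iff.2
    refine ⟨by positivity, ?_⟩
    rw [mul_pow, Real.sq_sqrt (Nat.cast_nonneg n)]
    calc ∑ i, ‖(a - b) i‖ ^ 2 ≤ ∑ _i : Fin n, M ^ 2 := by
          apply Finset.sum_le_sum
          intro i _
          have h := hMj i
          rw [PiLp.sub_apply, Real.norm_eq_abs]
          gcongr
      _ = n * M ^ 2 := by simp
  have hak : |a k| ≤ r := by
    have h := PiLp.norm_apply_le a k
    rw [Real.norm_eq_abs] at h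
    exact h.trans ha
  have ha0 := norm_nonneg a
  have hb0 := norm_nonneg b
  have hbn : ‖b‖ ≤ r + s := by
    have h := norm_sub_norm_le b a
    linarith
  have hd : |‖a‖ - ‖b‖| ≤ ‖a - b‖ := abs_norm_sub_norm_le a b
  rw [hg, hg, PiLp.smul_apply, PiLp.smul_apply, smul_eq_mul, smul_eq_mul]
  set A := r ^ 2 - ‖a‖ ^ 2 + Q with hA
  set B := r ^ 2 - ‖b‖ ^ 2 + Q with hB
  have hAQ : Q ≤ A := by nlinarith
  have hBD : Δ ≤ B := by nlinarith
  have hAu : A ≤ r ^ 2 + Q := by nlinarith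
  have hBu : B ≤ r ^ 2 + Q := by nlinarith
  have hA0 : 0 < A := by linarith
  have hB0 : 0 < B := by linarith
  have hBA : |B - A| ≤ (2 * r + s) * (Real.sqrt n * M) := by
    have h : B - A = (‖a‖ + ‖b‖) * (‖a‖ - ‖b‖) := by rw [hA, hB]; ring
    rw [h, abs_mul, abs_of_nonneg (by positivity : 0 ≤ ‖a‖ + ‖b‖)]
    exact mul_le_mul (by linarith) (hd.trans hnorm) (abs_nonneg _) (by positivity)
  have e : 2 * (r ^ 2 + Q) / A ^ 2 * a k - 2 * (r ^ 2 + Q) / B ^ 2 * b k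
      = 2 * (r ^ 2 + Q) / B ^ 2 * (a k - b k)
        + 2 * (r ^ 2 + Q) * ((B - A) * (A + B) * a k) / (A ^ 2 * B ^ 2) := by
    field_simp
    ring
  rw [e]
  refine (abs_add_le _ _).trans (add_le_add ?_ ?_)
  · rw [abs_mul, abs_of_nonneg (by positivity : 0 ≤ 2 * (r ^ 2 + Q) / B ^ 2)]
    gcongr
  · rw [abs_div, abs_mul (2 * (r ^ 2 + Q)), abs_mul _ (a k), abs_mul (B - A),
      abs_of_nonneg (by positivity : 0 ≤ A ^ 2 * B ^ 2),
      abs_of_nonneg (by positivity : 0 ≤ 2 * (r ^ 2 + Q)),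
      abs_of_nonneg (by positivity : 0 ≤ A + B)]
    calc 2 * (r ^ 2 + Q) * (|B - A| * (A + B) * |a k|) / (A ^ 2 * B ^ 2)
        ≤ 2 * (r ^ 2 + Q) * (((2 * r + s) * (Real.sqrt n * M))
            * ((r ^ 2 + Q) + (r ^ 2 + Q)) * r) / (Q ^ 2 * Δ ^ 2) := by gcongr
      _ = _ := by ring
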